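/- Let a ≥ 1, k ≥ 0 and ℓ ≥ 1 be integers, let β be a composition, and set n = a + 1 + |β| + ℓ. Let A be the set of ∘-decorated Dyck paths (D,S) of size n with α^Rise(D,S) = (a+1, β), peak_∘(D,S) = k, rise_∘(D,S) = ℓ, and 1 ∈ S, and let B be the set of ∘-decorated Dyck paths (D',S') of size n − 1 with peak_∘(D',S') = k, rise_∘(D',S') = ℓ − 1, and α^Rise(D',S') = (β, γ) for some composition γ ⊨ a + 1. Then there exists a bijection Φ : A → B such that for every (D,S) ∈ A, dinv_∘(D,S) = dinv_∘(Φ(D,S)) + ℓ(β) and area_∘(D,S) = area_∘(Φ(D,S)) + a. -/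

import Mathlib

open Finset

namespace DeltaCat

/-- `i`-th entry (0-indexed) of an area sequence, defaulting to `0`. -/
def ent (l : List ℕ) (i : ℕ) : ℕ := l.getD i 0

/-- `l` is the area sequence of a Dyck path (of size `l.length ≥ 1`): it is nonempty,
starts with `0`, and consecutive entries increase by at most one. -/
def IsDyck (l : List ℕ) : Prop :=
  l ≠ [] ∧ ent l 0 = 0 ∧ ∀ i < l.length, i + 1 < l.length → ent l (i + 1) ≤ ent l i + 1

instance (l : List ℕ) : Decidable (IsDyck l) := by unfold IsDyck; infer_instance

/-- the area of a Dyck path -/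
def area (l : List ℕ) : ℕ := l.sum

/-- the diagonal inversions of a Dyck path: pairs `(i,j)`, `i < j`, with
`a_i = a_j` or `a_i = a_j + 1` (0-indexed rows). -/
def dinvPairs (l : List ℕ) : Finset (ℕ × ℕ) :=
  (Finset.range l.length ×ˢ Finset.range l.length).filter
    (fun p => p.1 < p.2 ∧ (ent l p.1 = ent l p.2 ∨ ent l p.1 = ent l p.2 + 1))

/-- the number of diagonal inversions -/
def dinv (l : List ℕ) : ℕ := (dinvPairs l).card

/-- `b'(k) = #{j > k : a_j = a_k} + #{j < k : a_j = a_k + 1}` (0-indexed rows). -/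
def bval (l : List ℕ) (k : ℕ) : ℕ :=
  ((Finset.range l.length).filter (fun j => k < j ∧ ent l j = ent l k)).card +
  ((Finset.range l.length).filter (fun j => j < k ∧ ent l j = ent l k + 1)).card

/-- row `i` (0-indexed) is a double rise -/
def IsRise (l : List ℕ) (i : ℕ) : Prop := i + 1 < l.length ∧ ent l (i + 1) = ent l i + 1

instance (l : List ℕ) (i : ℕ) : Decidable (IsRise l i) := by unfold IsRise; infer_instance

/-- row `i` (0-indexed) is a peak -/
def IsPeak (l : List ℕ) (i : ℕ) : Prop := i < l.length ∧ ¬ IsRise l i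

instance (l : List ℕ) (i : ℕ) : Decidable (IsPeak l i) := by unfold IsPeak; infer_instance

/-- `Rise_∘(D,S)`: the decorated rows which are double rises -/
def riseSet (l : List ℕ) (S : Finset ℕ) : Finset ℕ := S.filter (fun i => IsRise l i)

/-- `Peak_∘(D,S)`: the decorated rows which are peaks -/
def peakSet (l : List ℕ) (S : Finset ℕ) : Finset ℕ := S.filter (fun i => IsPeak l i)

/-- `area_∘(D,S)` -/
def areaC (l : List ℕ) (S : Finset ℕ) : ℕ := area l - ∑ i ∈ riseSet l S, ent l (i + 1)

/-- `dinv_∘(D,S)` -/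
def dinvC (l : List ℕ) (S : Finset ℕ) : ℕ := dinv l - ∑ i ∈ peakSet l S, bval l i

/-- the largest row index (0-indexed) attaining the maximal area value -/
def lastMaxRow (l : List ℕ) : ℕ :=
  ((Finset.range l.length).filter
    (fun i => ∀ j ∈ Finset.range l.length, ent l j ≤ ent l i)).sup id

/-- `S` is a valid set of ∘-decorations on the rows of `l` : a set of rows not containing
the largest index attaining the maximal area value. -/
def ValidDec (l : List ℕ) (S : Finset ℕ) : Prop :=
  (∀ i ∈ S, i < l.length) ∧ lastMaxRow l ∉ S

instance (l : List ℕ) (S : Finset ℕ) : Decidable (ValidDec l S) := by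
  unfold ValidDec; infer_instance

/-- the (0-indexed) rows where the path touches the diagonal, i.e. the starts of segments -/
def segStarts (l : List ℕ) : List ℕ :=
  (List.range l.length).filter (fun i => ent l i == 0)

/-- the touch composition of a Dyck path: the list of lengths of the maximal segments -/
def touchComp (l : List ℕ) : List ℕ :=
  List.zipWith (fun cur next => next - cur) (segStarts l) ((segStarts l).drop 1 ++ [l.length])

/-- the rise-touch composition `α^Rise(D,S)`: the touch composition with the number of
decorated double rises in each segment subtracted from the corresponding part. -/
def riseTouch (l : List ℕ) (S : Finset ℕ) : List ℕ :=
  List.zipWith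
    (fun cur next => (next - cur) - ((riseSet l S).filter (fun i => cur ≤ i ∧ i < next)).card)
    (segStarts l) ((segStarts l).drop 1 ++ [l.length])

/-- all lists of length `n` with entries at most `n`; this contains every Dyck path
area sequence of size `n`. -/
def allSeqs (n : ℕ) : Finset (List ℕ) :=
  (Finset.univ : Finset (Fin n → Fin (n + 1))).image fun v => (List.ofFn v).map Fin.val

/-- the Finset of all Dyck paths of size `n` (encoded by their area sequences) -/
def dyckPaths (n : ℕ) : Finset (List ℕ) := (allSeqs n).filter IsDyck

/-- the Finset of all ∘-decorated Dyck paths of size `n` -/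
def decPaths (n : ℕ) : Finset (List ℕ × Finset ℕ) :=
  ((allSeqs n) ×ˢ (Finset.range n).powerset).filter fun p => IsDyck p.1 ∧ ValidDec p.1 p.2

/-- `Cat^Rise_{α,k,ℓ}(q,t)`, the generating function of ∘-decorated Dyck paths of size
`|α| + ℓ` with `k` decorated peaks, `ℓ` decorated double rises and rise-touch composition
`α`, by the statistics `dinv_∘` and `area_∘`; it is `0` when `k < 0` or `ℓ < 0`. -/
def CatRise {R : Type*} [CommRing R] (q t : R) (α : List ℕ) (k ℓ : ℤ) : R :=
  if 0 ≤ k ∧ 0 ≤ ℓ then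
    ∑ p ∈ (decPaths (α.sum + ℓ.toNat)).filter
        (fun p => (peakSet p.1 p.2).card = k.toNat ∧ (riseSet p.1 p.2).card = ℓ.toNat ∧
          riseTouch p.1 p.2 = α),
      q ^ dinvC p.1 p.2 * t ^ areaC p.1 p.2
  else 0

end DeltaCat

open DeltaCat

namespace DeltaCat

theorem ent_append_left {U : List ℕ} (V : List ℕ) {i : ℕ} (h : i < U.length) :
    ent (U ++ V) i = ent U i := by
  simp [ent, List.getElem?_append_left h]

theorem ent_append_right (U V : List ℕ) (i : ℕ) :
    ent (U ++ V) (i + U.length) = ent V i := by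
  simp [ent, List.getElem?_append_right]

theorem ent_map_succ {X : List ℕ} {i : ℕ} (h : i < X.length) :
    ent (X.map (· + 1)) i = ent X i + 1 := by
  simp [ent, h]

theorem ent_cons_succ (x : ℕ) (l : List ℕ) (i : ℕ) : ent (x :: l) (i + 1) = ent l i := by
  simp [ent]

theorem sum_ent (l : List ℕ) : ∑ i ∈ range l.length, ent l i = area l := by
  induction l with
  | nil => simp [area]
  | cons x l ih =>
    rw [List.length_cons, Finset.sum_range_succ']
    simp only [ent_cons_succ, ih, area, List.sum_cons]
    simp [ent, add_comm]

theorem IsDyck.ent_le {l : List ℕ} (h : IsDyck l) : ∀ i < l.length, ent l i ≤ i := by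
  intro i
  induction i with
  | zero => intro _; exact h.2.1.le
  | succ i ih =>
    intro hi
    have := h.2.2 i (by omega) hi
    have := ih (by omega)
    omega

theorem length_of_mem_allSeqs {n : ℕ} {l : List ℕ} (h : l ∈ allSeqs n) : l.length = n := by
  simp only [allSeqs, mem_image, mem_univ, true_and] at h
  obtain ⟨v, rfl⟩ := h
  simp

theorem IsDyck.mem_allSeqs {l : List ℕ} (h : IsDyck l) : l ∈ allSeqs l.length := by
  simp only [allSeqs, mem_image, mem_univ, true_and]
  refine ⟨fun i => ⟨ent l i, by have := h.ent_le i i.2; omega⟩, ?_⟩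
  apply List.ext_getElem
  · simp
  · intro i h1 h2
    simp [ent]

theorem mem_decPaths {n : ℕ} {p : List ℕ × Finset ℕ} :
    p ∈ decPaths n ↔ p.1.length = n ∧ IsDyck p.1 ∧ ValidDec p.1 p.2 := by
  simp only [decPaths, mem_filter, mem_product, mem_powerset]
  constructor
  · rintro ⟨⟨h1, _⟩, h2⟩
    exact ⟨length_of_mem_allSeqs h1, h2⟩
  · rintro ⟨rfl, h1, h2⟩
    exact ⟨⟨h1.mem_allSeqs, fun i hi => mem_range.2 (h2.1 i hi)⟩, h1, h2⟩

theorem lastMaxRow_eq {l : List ℕ} {i : ℕ} (hi : i < l.length)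
    (h : ∀ j < l.length, ent l j ≤ ent l i ∧ (ent l j = ent l i → j ≤ i)) :
    lastMaxRow l = i := by
  apply le_antisymm
  · refine Finset.sup_le fun j hj => ?_
    simp only [mem_filter, mem_range] at hj
    exact (h j hj.1).2 (le_antisymm (h j hj.1).1 (hj.2 i hi))
  · refine Finset.le_sup (f := id) ?_
    simp only [mem_filter, mem_range]
    exact ⟨hi, fun j hj => (h j hj).1⟩

theorem lastMaxRow_spec {l : List ℕ} (hl : 0 < l.length) :
    lastMaxRow l < l.length ∧ ∀ j < l.length,
      ent l j ≤ ent l (lastMaxRow l) ∧ (ent l j = ent l (lastMaxRow l) → j ≤ lastMaxRow l) := by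
  set s := (range l.length).filter (fun i => ∀ j ∈ range l.length, ent l j ≤ ent l i) with hs
  have hne : s.Nonempty := by
    obtain ⟨i, hi, h⟩ := (range l.length).exists_max_image (ent l) ⟨0, mem_range.2 hl⟩
    exact ⟨i, by simp only [hs, mem_filter]; exact ⟨hi, h⟩⟩
  obtain ⟨i, hi, h⟩ := Finset.exists_mem_eq_sup s hne id
  have hi' : lastMaxRow l = i := h
  rw [hi']
  simp only [hs, mem_filter, mem_range] at hi
  refine ⟨hi.1, fun j hj => ⟨hi.2 j hj, fun hji => ?_⟩⟩
  have : j ≤ s.sup id := by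
    refine Finset.le_sup (f := id) ?_
    simp only [hs, mem_filter, mem_range]
    exact ⟨hj, fun j' hj' => hji ▸ hi.2 j' hj'⟩
  simpa [h] using this

/-- Every diagonal inversion is counted by `bval` at exactly one of its two rows. -/
theorem dinv_eq_sum_bval (l : List ℕ) : dinv l = ∑ k ∈ range l.length, bval l k := by
  have h : ∀ i j : ℕ,
      (if i < j ∧ (ent l i = ent l j ∨ ent l i = ent l j + 1) then 1 else 0) =
      (if i < j ∧ ent l j = ent l i then 1 else 0) +
        (if i < j ∧ ent l i = ent l j + 1 then 1 else 0) := by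
    intro i j
    split_ifs <;> omega
  simp only [dinv, dinvPairs, bval, card_filter, sum_product, h, sum_add_distrib]
  congr 1
  exact sum_comm

theorem peakSet_subset (l : List ℕ) (S : Finset ℕ) : peakSet l S ⊆ range l.length := by
  intro i hi
  exact mem_range.2 (mem_filter.1 hi).2.1

theorem dinvC_eq_sum (l : List ℕ) (S : Finset ℕ) :
    dinvC l S = ∑ k ∈ range l.length \ peakSet l S, bval l k := by
  rw [dinvC, dinv_eq_sum_bval, ← sum_sdiff (peakSet_subset l S), Nat.add_sub_cancel]

theorem areaC_add (l : List ℕ) (S : Finset ℕ) :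
    areaC l S + ∑ i ∈ riseSet l S, ent l (i + 1) = area l := by
  refine Nat.sub_add_cancel ?_
  rw [← sum_ent, ← sum_image (s := riseSet l S) (g := (· + 1)) (f := ent l) (by simp)]
  refine sum_le_sum_of_subset fun j hj => ?_
  obtain ⟨i, hi, rfl⟩ := mem_image.1 hj
  exact mem_range.2 (mem_filter.1 hi).2.1

theorem bval_eq_card (l : List ℕ) (k : ℕ) :
    bval l k = ((range l.length).filter (fun j =>
      (k < j ∧ ent l j = ent l k) ∨ (j < k ∧ ent l j = ent l k + 1))).card := by
  rw [bval, filter_or, card_union_of_disjoint]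
  refine disjoint_filter.2 fun j _ h1 h2 => ?_
  omega

/-- The row of the path `0, x₁ + 1, …, xₘ + 1, y₁, …, yₜ` corresponding to row `i` of the
rotated path `y₁, …, yₜ, x₁, …, xₘ`. -/
def rotRow (t m i : ℕ) : ℕ := if i < t then i + m + 1 else i - t + 1

theorem rotRow_of_lt {t m i : ℕ} (h : i < t) : rotRow t m i = i + m + 1 := if_pos h

theorem rotRow_add (t m i : ℕ) : rotRow t m (t + i) = i + 1 := by
  simp [rotRow]

/-- `l'` with decorations `S'` is obtained from `l` with decorations `S` by removing the
decorated first row, lowering the next `m ≥ 1` rows by one, and moving them behind the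
remaining `t` rows, decorations being carried along. -/
structure IsRotation (l : List ℕ) (S : Finset ℕ) (l' : List ℕ) (S' : Finset ℕ) (t m : ℕ) :
    Prop where
  length_left : l.length = t + m + 1
  length_right : l'.length = t + m
  pos : 0 < m
  ent_zero : ent l 0 = 0
  ent_tail : ∀ i < t, ent l (i + m + 1) = ent l' i
  ent_head : ∀ i < m, ent l (i + 1) = ent l' (t + i) + 1
  ent_right_zero : ent l' 0 = 0
  ent_right_cut : ent l' t = 0
  zero_mem : 0 ∈ S
  lt_left : ∀ i ∈ S, i < t + m + 1
  lt_right : ∀ i ∈ S', i < t + m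
  mem_iff : ∀ i < t + m, rotRow t m i ∈ S ↔ i ∈ S'

namespace IsRotation

variable {l l' : List ℕ} {S S' : Finset ℕ} {t m : ℕ}

theorem rotRow_injOn (t m : ℕ) : Set.InjOn (rotRow t m) (range (t + m)) := by
  intro i hi j hj h
  simp only [coe_range, Set.mem_Iio] at hi hj
  unfold rotRow at h
  split_ifs at h <;> omega

theorem range_eq (t m : ℕ) :
    range (t + m + 1) = insert 0 ((range (t + m)).image (rotRow t m)) := by
  ext i
  simp only [mem_range, mem_insert, mem_image]
  constructor
  · intro hi
    rcases Nat.eq_zero_or_pos i with h | h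
    · exact Or.inl h
    · by_cases hm : i ≤ m
      · exact Or.inr ⟨t + (i - 1), by omega, by rw [rotRow_add]; omega⟩
      · exact Or.inr ⟨i - m - 1, by omega, by rw [rotRow_of_lt] <;> omega⟩
  · rintro (rfl | ⟨j, hj, rfl⟩)
    · omega
    · unfold rotRow
      split_ifs <;> omega

theorem zero_notMem_image (t m : ℕ) (s : Finset ℕ) : 0 ∉ s.image (rotRow t m) := by
  intro h
  obtain ⟨i, _, hi⟩ := mem_image.1 h
  unfold rotRow at hi
  split_ifs at hi

theorem ent_rotRow (h : IsRotation l S l' S' t m) {i : ℕ} (hi : i < t + m) :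
    ent l (rotRow t m i) = ent l' i + if i < t then 0 else 1 := by
  split_ifs with ht
  · rw [rotRow_of_lt ht, h.ent_tail i ht, add_zero]
  · obtain ⟨j, rfl⟩ := Nat.exists_eq_add_of_le (not_lt.1 ht)
    rw [rotRow_add, h.ent_head j (by omega)]

theorem isDyck_left (h : IsRotation l S l' S' t m) (hd : IsDyck l') : IsDyck l := by
  refine ⟨List.ne_nil_of_length_pos (by rw [h.length_left]; omega), h.ent_zero, ?_⟩
  intro i _ hi
  rw [h.length_left] at hi
  have hd' := hd.2.2
  simp only [h.length_right] at hd'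
  by_cases hi0 : i = 0
  · subst hi0
    have := h.ent_head 0 h.pos
    have := h.ent_right_cut
    simp_all
  by_cases him : i < m
  · have h1 := h.ent_head (i - 1) (by omega)
    have h2 := h.ent_head i him
    have h3 := hd' (t + (i - 1)) (by omega) (by omega)
    rw [show t + (i - 1) + 1 = t + i by omega] at h3
    rw [show i - 1 + 1 = i by omega] at h1
    omega
  by_cases hie : i = m
  · subst hie
    have := h.ent_tail 0 (by omega)
    have := h.ent_right_zero
    simp_all
  · obtain ⟨j, rfl⟩ := Nat.exists_eq_add_of_le (show m + 1 ≤ i by omega)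
    have h1 := h.ent_tail j (by omega)
    have h2 := h.ent_tail (j + 1) (by omega)
    have h3 := hd' j (by omega) (by omega)
    rw [show m + 1 + j + 1 = j + 1 + m + 1 by omega, show m + 1 + j = j + m + 1 by omega]
    omega

theorem isDyck_right (h : IsRotation l S l' S' t m) (hd : IsDyck l) : IsDyck l' := by
  have hm := h.pos
  refine ⟨List.ne_nil_of_length_pos (by rw [h.length_right]; omega), h.ent_right_zero, ?_⟩
  intro i _ hi
  rw [h.length_right] at hi
  have hd' := hd.2.2
  simp only [h.length_left] at hd'
  by_cases hit : i + 1 < t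
  · have h1 := h.ent_tail i (by omega)
    have h2 := h.ent_tail (i + 1) (by omega)
    have h3 := hd' (i + m + 1) (by omega) (by omega)
    rw [show i + m + 1 + 1 = i + 1 + m + 1 by omega] at h3
    omega
  by_cases hie : i + 1 = t
  · rw [hie, h.ent_right_cut]
    omega
  · obtain ⟨j, rfl⟩ := Nat.exists_eq_add_of_le (show t ≤ i by omega)
    have h1 := h.ent_head j (by omega)
    have h2 := h.ent_head (j + 1) (by omega)
    have h3 := hd' (j + 1) (by omega) (by omega)
    rw [show t + (j + 1) = t + j + 1 by omega] at h2
    omega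

theorem isRise_iff (h : IsRotation l S l' S' t m) {i : ℕ} (hi : i < t + m) :
    IsRise l (rotRow t m i) ↔ IsRise l' i := by
  have hm := h.pos
  unfold IsRise
  rw [h.length_left, h.length_right, h.ent_rotRow hi]
  by_cases hit : i < t
  · rw [rotRow_of_lt hit, if_pos hit]
    by_cases hie : i + 1 = t
    · have := h.ent_right_cut
      rw [← hie] at this
      omega
    · have := h.ent_tail (i + 1) (by omega)
      rw [show i + 1 + m + 1 = i + m + 1 + 1 by omega] at this
      omega
  · obtain ⟨j, rfl⟩ := Nat.exists_eq_add_of_le (show t ≤ i by omega)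
    rw [rotRow_add, if_neg hit]
    by_cases hje : j + 1 = m
    · by_cases ht : t = 0
      · omega
      · have h1 := h.ent_tail 0 (by omega)
        have h2 := h.ent_right_zero
        rw [show j + 1 + 1 = 0 + m + 1 by omega]
        omega
    · have := h.ent_head (j + 1) (by omega)
      rw [show t + (j + 1) = t + j + 1 by omega] at this
      omega

theorem isRise_zero (h : IsRotation l S l' S' t m) : IsRise l 0 := by
  have h1 := h.ent_head 0 h.pos
  have h2 := h.ent_right_cut
  refine ⟨by rw [h.length_left]; have := h.pos; omega, ?_⟩
  rw [h.ent_zero, h1, add_zero, h2]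

theorem left_eq (h : IsRotation l S l' S' t m) :
    S = insert 0 (S'.image (rotRow t m)) := by
  ext i
  simp only [mem_insert, mem_image]
  constructor
  · intro hi
    have : i ∈ range (t + m + 1) := mem_range.2 (h.lt_left i hi)
    rw [range_eq, mem_insert, mem_image] at this
    rcases this with h0 | ⟨j, hj, rfl⟩
    · exact Or.inl h0
    · exact Or.inr ⟨j, (h.mem_iff j (mem_range.1 hj)).1 hi, rfl⟩
  · rintro (rfl | ⟨j, hj, rfl⟩)
    · exact h.zero_mem
    · exact (h.mem_iff j (h.lt_right j hj)).2 hj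

theorem right_eq (h : IsRotation l S l' S' t m) :
    S' = (range (t + m)).filter (fun i => rotRow t m i ∈ S) := by
  ext i
  simp only [mem_filter, mem_range]
  exact ⟨fun hi => ⟨h.lt_right i hi, (h.mem_iff i (h.lt_right i hi)).2 hi⟩,
    fun hi => (h.mem_iff i hi.1).1 hi.2⟩

theorem riseSet_eq (h : IsRotation l S l' S' t m) :
    riseSet l S = insert 0 ((riseSet l' S').image (rotRow t m)) := by
  rw [riseSet, riseSet, h.left_eq, filter_insert, if_pos h.isRise_zero, filter_image]
  congr 2
  exact filter_congr fun i hi => h.isRise_iff (h.lt_right i hi)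

theorem peakSet_eq (h : IsRotation l S l' S' t m) :
    peakSet l S = (peakSet l' S').image (rotRow t m) := by
  rw [peakSet, peakSet, h.left_eq, filter_insert, if_neg (fun hp => hp.2 h.isRise_zero),
    filter_image]
  congr 1
  refine filter_congr fun i hi => ?_
  have hi' := h.lt_right i hi
  have : rotRow t m i < t + m + 1 := h.lt_left _ ((h.mem_iff i hi').2 hi)
  unfold IsPeak
  rw [h.isRise_iff hi', h.length_left, h.length_right]
  simp [hi', this]

theorem peakSet_subset_range (h : IsRotation l S l' S' t m) :
    peakSet l' S' ⊆ range (t + m) := fun i hi =>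
  mem_range.2 (h.lt_right i (mem_filter.1 hi).1)

theorem riseSet_subset_range (h : IsRotation l S l' S' t m) :
    riseSet l' S' ⊆ range (t + m) := fun i hi =>
  mem_range.2 (h.lt_right i (mem_filter.1 hi).1)

theorem card_peakSet (h : IsRotation l S l' S' t m) :
    (peakSet l S).card = (peakSet l' S').card := by
  rw [h.peakSet_eq]
  exact card_image_of_injOn ((rotRow_injOn t m).mono (by exact_mod_cast h.peakSet_subset_range))

theorem card_riseSet (h : IsRotation l S l' S' t m) :
    (riseSet l S).card = (riseSet l' S').card + 1 := by
  rw [h.riseSet_eq, card_insert_of_notMem (zero_notMem_image _ _ _)]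
  rw [card_image_of_injOn ((rotRow_injOn t m).mono (by exact_mod_cast h.riseSet_subset_range))]

theorem lastMaxRow_eq (h : IsRotation l S l' S' t m) :
    lastMaxRow l = rotRow t m (lastMaxRow l') := by
  have hm := h.pos
  obtain ⟨h1, h2⟩ := lastMaxRow_spec (l := l') (by rw [h.length_right]; omega)
  rw [h.length_right] at h1 h2
  set i := lastMaxRow l'
  have hlt : rotRow t m i ∈ range (t + m + 1) := by
    rw [range_eq]
    exact mem_insert_of_mem (mem_image_of_mem _ (mem_range.2 h1))
  refine DeltaCat.lastMaxRow_eq (by rw [h.length_left]; exact mem_range.1 hlt) ?_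
  intro j hj
  rw [h.length_left, ← mem_range, range_eq, mem_insert, mem_image] at hj
  rcases hj with rfl | ⟨j, hj, rfl⟩
  · rw [h.ent_zero]
    exact ⟨Nat.zero_le _, fun _ => Nat.zero_le _⟩
  · rw [mem_range] at hj
    rw [h.ent_rotRow hj, h.ent_rotRow h1]
    have := h2 j hj
    unfold rotRow
    split_ifs <;> omega

theorem validDec_iff (h : IsRotation l S l' S' t m) : ValidDec l S ↔ ValidDec l' S' := by
  have hm := h.pos
  have h1 := (lastMaxRow_spec (l := l') (by rw [h.length_right]; omega)).1
  rw [h.length_right] at h1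
  unfold ValidDec
  rw [h.length_left, h.length_right, h.lastMaxRow_eq, h.mem_iff _ h1]
  exact and_congr_left fun _ => ⟨fun _ => h.lt_right, fun _ => h.lt_left⟩

theorem bval_rotRow (h : IsRotation l S l' S' t m) {k : ℕ} (hk : k < t + m) :
    bval l (rotRow t m k) = bval l' k := by
  rw [bval_eq_card, bval_eq_card, h.length_left, h.length_right, range_eq, filter_insert,
    if_neg (by rw [h.ent_zero]; omega), filter_image, card_image_of_injOn]
  · congr 1
    refine filter_congr fun j hj => ?_
    rw [mem_range] at hj
    rw [h.ent_rotRow hj, h.ent_rotRow hk]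
    unfold rotRow
    split_ifs <;> omega
  · refine (rotRow_injOn t m).mono ?_
    exact_mod_cast filter_subset _ _

theorem dinvC_eq (h : IsRotation l S l' S' t m) : dinvC l S = dinvC l' S' + bval l 0 := by
  rw [dinvC_eq_sum, dinvC_eq_sum, h.length_left, h.length_right, range_eq, h.peakSet_eq,
    insert_sdiff_of_notMem _ (zero_notMem_image _ _ _),
    sum_insert (fun h0 => zero_notMem_image _ _ _ (mem_sdiff.1 h0).1), add_comm]
  congr 1
  rw [← image_sdiff_of_injOn (rotRow_injOn t m) h.peakSet_subset_range, sum_image]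
  · refine sum_congr rfl fun k hk => h.bval_rotRow ?_
    exact mem_range.1 (mem_sdiff.1 hk).1
  · refine (rotRow_injOn t m).mono ?_
    exact_mod_cast sdiff_subset

theorem area_eq (h : IsRotation l S l' S' t m) : area l = area l' + m := by
  rw [← sum_ent, ← sum_ent, h.length_left, h.length_right, range_eq,
    sum_insert (zero_notMem_image _ _ _), h.ent_zero, zero_add, sum_image (rotRow_injOn t m),
    sum_congr rfl fun i hi => h.ent_rotRow (mem_range.1 hi), sum_add_distrib]
  congr 1
  rw [sum_range_add, sum_congr rfl (g := fun _ => 0) (by simp +contextual)]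
  simp

theorem areaC_eq (h : IsRotation l S l' S' t m) :
    areaC l S + 1 + ((riseSet l' S').filter (t ≤ ·)).card = areaC l' S' + m := by
  have h1 := areaC_add l S
  have h2 := areaC_add l' S'
  have h3 : ∑ i ∈ riseSet l' S', ent l (rotRow t m i + 1) =
      ∑ i ∈ riseSet l' S', ent l' (i + 1) + ((riseSet l' S').filter (t ≤ ·)).card := by
    rw [card_filter, ← sum_add_distrib]
    refine sum_congr rfl fun i hi => ?_
    have hi' := mem_range.1 (h.riseSet_subset_range hi)
    have hr := (mem_filter.1 hi).2
    rw [hr.2, ((h.isRise_iff hi').2 hr).2, h.ent_rotRow hi']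
    split_ifs <;> omega
  rw [h.riseSet_eq, sum_insert (zero_notMem_image _ _ _), sum_image, h3, h.isRise_zero.2,
    h.ent_zero, h.area_eq] at h1
  · omega
  · exact (rotRow_injOn t m).mono (by exact_mod_cast h.riseSet_subset_range)

end IsRotation

theorem segStarts_append (U V : List ℕ) :
    segStarts (U ++ V) = segStarts U ++ (segStarts V).map (· + U.length) := by
  unfold segStarts
  rw [List.length_append, List.range_add, List.filter_append, List.filter_map]
  congr 1
  · refine List.filter_congr fun i hi => ?_
    rw [ent_append_left V (List.mem_range.1 hi)]
  · rw [List.map_congr_left (g := (· + U.length)) fun i _ => add_comm _ _]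
    congr 1
    refine List.filter_congr fun i _ => ?_
    simp only [Function.comp, add_comm U.length i, ent_append_right]

theorem length_segStarts (l : List ℕ) : (segStarts l).length = l.count 0 := by
  induction l with
  | nil => rfl
  | cons x l ih =>
    rw [show x :: l = [x] ++ l from rfl, segStarts_append, List.length_append, List.length_map,
      ih, List.count_append]
    congr 1
    by_cases hx : x = 0
    · subst hx; rfl
    · simp [segStarts, ent, hx]

theorem lt_of_mem_segStarts {l : List ℕ} {i : ℕ} (h : i ∈ segStarts l) : i < l.length :=
  List.mem_range.1 (List.mem_filter.1 h).1

theorem length_riseTouch (l : List ℕ) (S : Finset ℕ) : (riseTouch l S).length = l.count 0 := by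
  rw [← length_segStarts, riseTouch]
  simp only [List.length_zipWith, List.length_append, List.length_drop, List.length_singleton]
  omega

theorem bval_zero {l : List ℕ} (hl : 0 < l.length) (h : ent l 0 = 0) :
    bval l 0 + 1 = l.count 0 := by
  have h1 : ((range l.length).filter (fun j => ent l j = 0)).card = l.count 0 := by
    rw [← length_segStarts, segStarts, ← Nat.count_eq_card_filter_range, Nat.count,
      List.countP_eq_length_filter]
    congr 1
  have h2 : (range l.length).filter (fun j => ent l j = 0) =
      insert 0 ((range l.length).filter (fun j => 0 < j ∧ ent l j = 0)) := by
    ext j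
    simp only [mem_filter, mem_insert, mem_range]
    rcases Nat.eq_zero_or_pos j with rfl | hj
    · simp [hl, h]
    · simp [hj, hj.ne']
  rw [← h1, h2, card_insert_of_notMem (by simp)]
  simp [bval, h]

theorem zipWith_congr_right {α β γ : Type*} {f g : α → β → γ} (L : List α) {M : List β}
    (h : ∀ x, ∀ y ∈ M, f x y = g x y) : List.zipWith f L M = List.zipWith g L M := by
  induction L generalizing M with
  | nil => rfl
  | cons x L ih =>
    cases M with
    | nil => rfl
    | cons y M =>
      rw [List.zipWith_cons_cons, List.zipWith_cons_cons, h x y (by simp),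
        ih fun x y hy => h x y (List.mem_cons_of_mem _ hy)]

section Append

variable {U V : List ℕ} {S SU SV : Finset ℕ}

theorem isRise_append_left (hV : ent V 0 = 0) {i : ℕ} (hi : i < U.length) :
    IsRise (U ++ V) i ↔ IsRise U i := by
  unfold IsRise
  rw [List.length_append, ent_append_left V hi]
  by_cases h : i + 1 < U.length
  · rw [ent_append_left V h]
    omega
  · have : ent (U ++ V) (i + 1) = 0 := by
      rw [show i + 1 = 0 + U.length by omega, ent_append_right, hV]
    omega

theorem isRise_append_right (U V : List ℕ) (i : ℕ) :
    IsRise (U ++ V) (i + U.length) ↔ IsRise V i := by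
  unfold IsRise
  rw [List.length_append, ent_append_right, show i + U.length + 1 = i + 1 + U.length by omega,
    ent_append_right]
  omega

theorem mem_riseSet_append_left (hV : ent V 0 = 0) (hU : ∀ i < U.length, i ∈ S ↔ i ∈ SU)
    {i : ℕ} (hi : i < U.length) : i ∈ riseSet (U ++ V) S ↔ i ∈ riseSet U SU := by
  simp only [riseSet, mem_filter, isRise_append_left hV hi, hU i hi]

theorem mem_riseSet_append_right (hS : ∀ i < V.length, i + U.length ∈ S ↔ i ∈ SV) (i : ℕ) :
    i + U.length ∈ riseSet (U ++ V) S ↔ i ∈ riseSet V SV := by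
  simp only [riseSet, mem_filter, isRise_append_right]
  exact and_congr_left fun h => hS i (by have := h.1; omega)

theorem lt_of_mem_riseSet {l : List ℕ} {i : ℕ} (h : i ∈ riseSet l S) : i + 1 < l.length :=
  (mem_filter.1 h).2.1

theorem riseSet_append_filter_ge (hS : ∀ i < V.length, i + U.length ∈ S ↔ i ∈ SV) :
    (riseSet (U ++ V) S).filter (U.length ≤ ·) = (riseSet V SV).image (· + U.length) := by
  ext i
  simp only [mem_filter, mem_image]
  constructor
  · rintro ⟨h, hi⟩
    obtain ⟨j, rfl⟩ := Nat.exists_eq_add_of_le' hi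
    exact ⟨j, (mem_riseSet_append_right hS j).1 h, rfl⟩
  · rintro ⟨j, hj, rfl⟩
    exact ⟨(mem_riseSet_append_right hS j).2 hj, by omega⟩

theorem card_riseSet_append_filter_ge (hS : ∀ i < V.length, i + U.length ∈ S ↔ i ∈ SV) :
    ((riseSet (U ++ V) S).filter (U.length ≤ ·)).card = (riseSet V SV).card := by
  rw [riseSet_append_filter_ge hS, card_image_of_injective _ (add_left_injective _)]

theorem card_riseSet_append (hV : ent V 0 = 0) (hU : ∀ i < U.length, i ∈ S ↔ i ∈ SU)
    (hS : ∀ i < V.length, i + U.length ∈ S ↔ i ∈ SV) :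
    (riseSet (U ++ V) S).card = (riseSet U SU).card + (riseSet V SV).card := by
  rw [← card_filter_add_card_filter_not (U.length ≤ ·), card_riseSet_append_filter_ge hS,
    add_comm]
  congr 2
  ext i
  simp only [mem_filter, not_le]
  constructor
  · rintro ⟨h, hi⟩
    exact (mem_riseSet_append_left hV hU hi).1 h
  · intro h
    have hi : i < U.length := by have := lt_of_mem_riseSet h; omega
    exact ⟨(mem_riseSet_append_left hV hU hi).2 h, hi⟩

theorem riseTouch_append (hV : ent V 0 = 0) (hU : ∀ i < U.length, i ∈ S ↔ i ∈ SU)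
    (hS : ∀ i < V.length, i + U.length ∈ S ↔ i ∈ SV) :
    riseTouch (U ++ V) S = riseTouch U SU ++ riseTouch V SV := by
  have left : ∀ c, ∀ d ≤ U.length,
      d - c - ((riseSet (U ++ V) S).filter (fun i => c ≤ i ∧ i < d)).card =
      d - c - ((riseSet U SU).filter (fun i => c ≤ i ∧ i < d)).card := by
    intro c d hd
    congr 2
    ext i
    simp only [mem_filter]
    exact and_congr_left fun h => mem_riseSet_append_left hV hU (by omega)
  have right : ∀ c d,
      (d + U.length) - (c + U.length) - ((riseSet (U ++ V) S).filter
        (fun i => c + U.length ≤ i ∧ i < d + U.length)).card =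
      d - c - ((riseSet V SV).filter (fun i => c ≤ i ∧ i < d)).card := by
    intro c d
    rw [Nat.add_sub_add_right]
    congr 1
    rw [← card_image_of_injective ((riseSet V SV).filter _) (add_left_injective U.length)]
    congr 1
    ext i
    simp only [mem_filter, mem_image]
    constructor
    · rintro ⟨h, hc, hd⟩
      obtain ⟨j, rfl⟩ := Nat.exists_eq_add_of_le' (show U.length ≤ i by omega)
      exact ⟨j, ⟨(mem_riseSet_append_right hS j).1 h, by omega, by omega⟩, rfl⟩
    · rintro ⟨j, ⟨hj, hc, hd⟩, rfl⟩
      exact ⟨(mem_riseSet_append_right hS j).2 hj, by omega, by omega⟩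
  have mem_le : ∀ d ∈ (segStarts U).drop 1 ++ [U.length], d ≤ U.length := by
    intro d hd
    rcases List.mem_append.1 hd with hd | hd
    · exact (lt_of_mem_segStarts (List.mem_of_mem_drop hd)).le
    · exact (List.mem_singleton.1 hd).le
  have hleft := zipWith_congr_right (segStarts U) fun c d hd => left c d (mem_le d hd)
  have hright : List.zipWith (fun c d =>
        d - c - ((riseSet (U ++ V) S).filter (fun i => c ≤ i ∧ i < d)).card)
      ((segStarts V).map (· + U.length))
      (((segStarts V).drop 1 ++ [V.length]).map (· + U.length)) = riseTouch V SV := by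
    rw [List.zipWith_map]
    exact zipWith_congr_right _ fun c d _ => right c d
  rw [← hright]
  unfold riseTouch
  rw [← hleft, segStarts_append]
  cases V with
  | nil => simp [segStarts]
  | cons v V =>
    obtain rfl : v = 0 := by simpa [ent] using hV
    obtain ⟨cs, hcs⟩ : ∃ cs, segStarts (0 :: V) = 0 :: cs := by
      rw [show 0 :: V = [0] ++ V from rfl, segStarts_append]
      exact ⟨_, rfl⟩
    rw [hcs]
    cases hL : segStarts U with
    | nil =>
      simp [add_comm]
    | cons u us =>
      rw [← List.zipWith_append (by simp)]
      simp [add_comm]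

end Append

theorem segStarts_eq_nil {l : List ℕ} (h : ∀ x ∈ l, x ≠ 0) : segStarts l = [] := by
  rw [← List.length_eq_zero_iff, length_segStarts, List.count_eq_zero]
  exact fun h0 => h 0 h0 rfl

theorem riseTouch_prime {Y : List ℕ} (hY : ∀ y ∈ Y, y ≠ 0) (S : Finset ℕ) :
    riseTouch (0 :: Y) S = [Y.length + 1 - (riseSet (0 :: Y) S).card] := by
  have h : segStarts (0 :: Y) = [0] := by
    rw [show 0 :: Y = [0] ++ Y from rfl, segStarts_append, segStarts_eq_nil hY]
    rfl
  unfold riseTouch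
  rw [h]
  simp only [List.drop_succ_cons, List.drop_nil, List.nil_append, List.zipWith_cons_cons,
    List.zipWith_nil_left, List.length_cons, Nat.sub_zero]
  congr 3
  refine filter_true_of_mem fun i hi => ⟨Nat.zero_le i, ?_⟩
  have := lt_of_mem_riseSet hi
  simp only [List.length_cons] at this
  omega

theorem card_riseSet_le (l : List ℕ) (S : Finset ℕ) : (riseSet l S).card ≤ l.length - 1 := by
  rw [← card_range (l.length - 1)]
  refine card_le_card fun i hi => mem_range.2 ?_
  have := lt_of_mem_riseSet hi
  omega

theorem exists_prime_append {l : List ℕ} (hl : l ≠ []) (h : ent l 0 = 0) :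
    ∃ Y V, l = (0 :: Y) ++ V ∧ (∀ y ∈ Y, y ≠ 0) ∧ ent V 0 = 0 := by
  cases l with
  | nil => exact absurd rfl hl
  | cons x l =>
    obtain rfl : x = 0 := by simpa [ent] using h
    refine ⟨l.takeWhile (· ≠ 0), l.dropWhile (· ≠ 0), ?_, ?_, ?_⟩
    · rw [List.cons_append, List.takeWhile_append_dropWhile]
    · intro y hy
      simpa using List.mem_takeWhile_imp hy
    · cases hd : l.dropWhile (· ≠ 0) with
      | nil => rfl
      | cons v V =>
        have := List.head_dropWhile_not (· ≠ 0) (l := l) (by rw [hd]; simp)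
        simp only [hd] at this
        exact not_not.1 (of_decide_eq_false this)

/-- The decorations of the suffix of a path starting at row `u` and having `v` rows. -/
def suffixDec (u v : ℕ) (S : Finset ℕ) : Finset ℕ := (range v).filter (fun i => i + u ∈ S)

theorem mem_suffixDec (u v : ℕ) (S : Finset ℕ) : ∀ i < v, i + u ∈ S ↔ i ∈ suffixDec u v S := by
  intro i hi
  simp [suffixDec, hi]

theorem riseTouch_sum_and_pos (l : List ℕ) (S : Finset ℕ) (h : ent l 0 = 0) :
    (riseTouch l S).sum + (riseSet l S).card = l.length ∧ ∀ x ∈ riseTouch l S, 0 < x := by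
  induction hn : l.length using Nat.strong_induction_on generalizing l S with
  | _ n ih =>
    subst hn
    by_cases hl : l = []
    · subst hl
      have := card_riseSet_le [] S
      simp only [List.length_nil] at this
      constructor
      · simp only [riseTouch, segStarts, List.length_nil, List.range_zero, List.filter_nil,
          List.zipWith_nil_left, List.sum_nil]
        omega
      · simp [riseTouch, segStarts]
    · obtain ⟨Y, V, rfl, hY, hV⟩ := exists_prime_append hl h
      have hS := mem_suffixDec (0 :: Y).length V.length S
      have hU : ∀ i < (0 :: Y).length, i ∈ S ↔ i ∈ S := fun _ _ => Iff.rfl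
      obtain ⟨h1, h2⟩ := ih V.length (by simp) V
        (suffixDec (0 :: Y).length V.length S) hV rfl
      have h3 := card_riseSet_le (0 :: Y) S
      rw [riseTouch_append hV hU hS, card_riseSet_append hV hU hS, riseTouch_prime hY]
      simp only [List.length_cons, Nat.add_sub_cancel] at h3
      constructor
      · simp only [List.sum_append, List.sum_singleton, List.length_append]
        simp only [List.length_cons] at *
        omega
      · intro x hx
        rcases List.mem_append.1 hx with hx | hx
        · rw [List.mem_singleton] at hx
          omega
        · exact h2 x hx

theorem isRotation_of_append {T X : List ℕ} {S S' : Finset ℕ} (hX : X ≠ []) (hX0 : ent X 0 = 0)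
    (hT0 : ent T 0 = 0) (h0 : 0 ∈ S) (hS : ∀ i ∈ S, i < T.length + X.length + 1)
    (hS' : ∀ i ∈ S', i < T.length + X.length)
    (hmem : ∀ i < T.length + X.length, rotRow T.length X.length i ∈ S ↔ i ∈ S') :
    IsRotation ((0 :: X.map (· + 1)) ++ T) S (T ++ X) S' T.length X.length where
  length_left := by simp only [List.length_append, List.length_cons, List.length_map]; omega
  length_right := by simp
  pos := List.length_pos_iff.2 hX
  ent_zero := rfl
  ent_tail := by
    intro i hi
    rw [ent_append_left X hi, ← ent_append_right (0 :: X.map (· + 1)) T i]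
    simp [add_assoc]
  ent_head := by
    intro i hi
    rw [add_comm T.length, ent_append_right, List.cons_append, ent_cons_succ,
      ent_append_left _ (by simpa using hi), ent_map_succ hi]
  ent_right_zero := by
    cases T with
    | nil => exact hX0
    | cons y T => exact hT0
  ent_right_cut := by
    have := ent_append_right T X 0
    rwa [zero_add, hX0] at this
  zero_mem := h0
  lt_left := hS
  lt_right := hS'
  mem_iff := hmem

/-- The rotation correspondence, together with the two blocks being exchanged. -/
structure IsBlockRotation (p q : List ℕ × Finset ℕ) (T X : List ℕ) : Prop where
  left : p.1 = (0 :: X.map (· + 1)) ++ T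
  right : q.1 = T ++ X
  isRotation : IsRotation p.1 p.2 q.1 q.2 T.length X.length
  head_zero : ent X 0 = 0
  tail_zero : ent T 0 = 0

namespace IsBlockRotation

variable {p q : List ℕ × Finset ℕ} {T X : List ℕ}

theorem exists_riseTouch (h : IsBlockRotation p q T X) :
    ∃ γ : List ℕ, riseTouch p.1 p.2 = γ.sum :: riseTouch T q.2 ∧
      riseTouch q.1 q.2 = riseTouch T q.2 ++ γ ∧ (∀ x ∈ γ, 0 < x) ∧
      γ.sum + ((riseSet q.1 q.2).filter (T.length ≤ ·)).card = X.length := by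
  have hr := h.isRotation
  obtain ⟨l, S⟩ := p
  obtain ⟨l', S'⟩ := q
  obtain rfl := h.left
  obtain rfl := h.right
  simp only at hr ⊢
  have hA := mem_suffixDec T.length X.length S'
  set A := suffixDec T.length X.length S'
  have hS : ∀ i < T.length, i + (0 :: X.map (· + 1)).length ∈ S ↔ i ∈ S' := by
    intro i hi
    have := hr.mem_iff i (by omega)
    rw [rotRow_of_lt hi] at this
    simpa [add_assoc] using this
  have hU : ∀ i < (0 :: X.map (· + 1)).length, i ∈ S ↔ i ∈ S := fun _ _ => Iff.rfl
  have hT : ∀ i < T.length, i ∈ S' ↔ i ∈ S' := fun _ _ => Iff.rfl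
  obtain ⟨h1, h2⟩ := riseTouch_sum_and_pos X A h.head_zero
  have c := hr.card_riseSet
  rw [card_riseSet_append h.tail_zero hU hS, card_riseSet_append h.head_zero hT hA] at c
  refine ⟨riseTouch X A, ?_, riseTouch_append h.head_zero hT hA, h2, ?_⟩
  · rw [riseTouch_append h.tail_zero hU hS, riseTouch_prime (by simp)]
    simp only [List.length_map, List.singleton_append, List.cons.injEq, and_true]
    omega
  · rw [card_riseSet_append_filter_ge hA]
    exact h1

theorem eq_right {q₁ q₂ : List ℕ × Finset ℕ} {T₁ T₂ X₁ X₂ : List ℕ}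
    (h₁ : IsBlockRotation p q₁ T₁ X₁) (h₂ : IsBlockRotation p q₂ T₂ X₂) : q₁ = q₂ := by
  have key : ∀ {q₁ q₂ : List ℕ × Finset ℕ} {T₁ T₂ X₁ X₂ : List ℕ},
      IsBlockRotation p q₁ T₁ X₁ → IsBlockRotation p q₂ T₂ X₂ → X₂.length ≤ X₁.length := by
    intro q₁ q₂ T₁ T₂ X₁ X₂ h₁ h₂
    by_contra! hlt
    have r₁ := h₁.isRotation
    have r₂ := h₂.isRotation
    have e₁ := r₁.length_left
    have e₂ := r₂.length_left
    have a₁ := r₁.ent_tail 0 (by omega)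
    have a₂ := r₂.ent_head X₁.length hlt
    have := r₁.ent_right_zero
    rw [zero_add] at a₁
    omega
  have hlen : X₁.length = X₂.length := le_antisymm (key h₂ h₁) (key h₁ h₂)
  have e := h₁.left.symm.trans h₂.left
  obtain ⟨eX, rfl⟩ := List.append_inj e (by simpa using hlen)
  obtain rfl : X₁ = X₂ := by
    refine List.map_injective_iff.2 (add_left_injective 1) ?_
    simpa using eX
  exact Prod.ext (h₁.right.trans h₂.right.symm)
    (h₁.isRotation.right_eq.trans h₂.isRotation.right_eq.symm)

theorem eq_left {p₁ p₂ : List ℕ × Finset ℕ} {T₁ T₂ X₁ X₂ : List ℕ}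
    (h₁ : IsBlockRotation p₁ q T₁ X₁) (h₂ : IsBlockRotation p₂ q T₂ X₂)
    (hc : T₁.count 0 = T₂.count 0) : p₁ = p₂ := by
  have key : ∀ {p₁ p₂ : List ℕ × Finset ℕ} {T₁ T₂ X₁ X₂ : List ℕ},
      IsBlockRotation p₁ q T₁ X₁ → IsBlockRotation p₂ q T₂ X₂ → T₁.count 0 = T₂.count 0 →
      T₂.length ≤ T₁.length := by
    intro p₁ p₂ T₁ T₂ X₁ X₂ h₁ h₂ hc
    by_contra! hlt
    have e := h₁.right.symm.trans h₂.right
    rcases List.append_eq_append_iff.1 e with ⟨Z, rfl, rfl⟩ | ⟨Z, rfl, rfl⟩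
    · cases Z with
      | nil => simp at hlt
      | cons z Z =>
        obtain rfl : z = 0 := by simpa [ent] using h₁.head_zero
        simp at hc
    · simp at hlt
  have hlen : T₁.length = T₂.length := le_antisymm (key h₂ h₁ hc.symm) (key h₁ h₂ hc)
  obtain ⟨rfl, rfl⟩ := List.append_inj (h₁.right.symm.trans h₂.right) hlen
  exact Prod.ext (h₁.left.trans h₂.left.symm)
    (h₁.isRotation.left_eq.trans h₂.isRotation.left_eq.symm)

end IsBlockRotation

theorem exists_isBlockRotation_right {p : List ℕ × Finset ℕ} {a : ℕ} {β : List ℕ} (ha : 1 ≤ a)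
    (hd : IsDyck p.1) (hv : ValidDec p.1 p.2) (h0 : 0 ∈ p.2)
    (ht : riseTouch p.1 p.2 = (a + 1) :: β) : ∃ q T X, IsBlockRotation p q T X := by
  obtain ⟨l, S⟩ := p
  obtain ⟨Y, T, rfl, hY, hT⟩ := exists_prime_append hd.1 hd.2.1
  obtain ⟨X, rfl⟩ : ∃ X : List ℕ, Y = X.map (· + 1) := by
    refine ⟨Y.map (· - 1), ?_⟩
    rw [List.map_map]
    conv_lhs => rw [← List.map_id Y]
    refine List.map_congr_left fun y hy => ?_
    have := hY y hy
    simp only [id, Function.comp]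
    omega
  have hX : X ≠ [] := by
    rintro rfl
    simp only at ht
    rw [riseTouch_append hT (fun _ _ => Iff.rfl) (mem_suffixDec _ _ S), riseTouch_prime hY] at ht
    simp only [List.singleton_append, List.cons.injEq, List.map_nil, List.length_nil] at ht
    omega
  have hX0 : ent X 0 = 0 := by
    cases X with
    | nil => rfl
    | cons x X =>
      have := hd.2.2 0 (by simp) (by simp)
      simpa [ent] using this
  refine ⟨(T ++ X, (range (T.length + X.length)).filter
    (fun i => rotRow T.length X.length i ∈ S)), T, X, rfl, rfl, ?_, hX0, hT⟩
  refine isRotation_of_append hX hX0 hT h0 (fun i hi => ?_) (fun i hi => ?_) (fun i hi => ?_)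
  · have := hv.1 i hi
    simp only [List.length_append, List.length_cons, List.length_map] at this
    omega
  · exact mem_range.1 (mem_filter.1 hi).1
  · simp [hi]

theorem exists_append_of_lt_count {l : List ℕ} {b : ℕ} (h : b < l.count 0) :
    ∃ T X, l = T ++ 0 :: X ∧ T.count 0 = b := by
  induction l generalizing b with
  | nil => simp at h
  | cons x l ih =>
    by_cases hx : x = 0
    · subst hx
      cases b with
      | zero => exact ⟨[], l, rfl, rfl⟩
      | succ b =>
        obtain ⟨T, X, rfl, hT⟩ := ih (b := b) (by simpa using h)
        exact ⟨0 :: T, X, rfl, by simp [hT]⟩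
    · obtain ⟨T, X, rfl, hT⟩ := ih (b := b) (by simpa [hx] using h)
      exact ⟨x :: T, X, rfl, by simp [hx, hT]⟩

theorem exists_isBlockRotation_left {q : List ℕ × Finset ℕ} {b : ℕ}
    (hd : IsDyck q.1) (hv : ValidDec q.1 q.2) (hb : b < q.1.count 0) :
    ∃ p T X, IsBlockRotation p q T X ∧ T.count 0 = b := by
  obtain ⟨l, S⟩ := q
  obtain ⟨T, X, rfl, hT⟩ := exists_append_of_lt_count hb
  have hT0 : ent T 0 = 0 := by
    cases T with
    | nil => rfl
    | cons y T => exact hd.2.1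
  have hlt : ∀ i ∈ S, i < T.length + (0 :: X).length := by
    intro i hi
    have := hv.1 i hi
    rwa [List.length_append] at this
  refine ⟨(_, insert 0 (S.image (rotRow T.length (0 :: X).length))), T, 0 :: X,
    ⟨rfl, rfl, ?_, rfl, hT0⟩, hT⟩
  refine isRotation_of_append (by simp) rfl hT0 (mem_insert_self _ _) (fun i hi => ?_) hlt
    (fun i hi => ?_)
  · rw [← mem_range, IsRotation.range_eq]
    refine insert_subset_insert 0 (image_subset_image fun j hj => ?_) hi
    exact mem_range.2 (hlt j hj)
  · constructor
    · intro h
      rcases mem_insert.1 h with h | h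
      · have hz := IsRotation.zero_notMem_image T.length (0 :: X).length {i}
        rw [← h] at hz
        exact absurd (mem_image_of_mem _ (mem_singleton_self i)) hz
      · obtain ⟨j, hj, e⟩ := mem_image.1 h
        rwa [← IsRotation.rotRow_injOn _ _ (by simpa using hlt j hj) (by simpa using hi) e]
    · exact fun h => mem_insert_of_mem (mem_image_of_mem _ h)

end DeltaCat

/-- Case 2 of Proposition 3.1: cyclic rotation is a bijection between ∘-decorated Dyck
paths of size `n = a + 1 + |β| + ℓ` with rise-touch composition `(a+1, β)`, `k` decorated
peaks, `ℓ` decorated double rises and decorated first row, and ∘-decorated Dyck paths of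
size `n - 1` with `k` decorated peaks, `ℓ - 1` decorated double rises and rise-touch
composition `(β, γ)` for some `γ ⊨ a + 1`; it shifts `dinv_∘` by `ℓ(β)` and `area_∘`
by `a`. -/
theorem rotation_bijection_decorated_first_step
    (a k ℓ n : ℕ) (ha : 1 ≤ a) (hℓ : 1 ≤ ℓ) (β : List ℕ) (hβ : ∀ x ∈ β, 0 < x)
    (hn : n = a + 1 + β.sum + ℓ) :
    ∃ Φ : {p : List ℕ × Finset ℕ // p ∈ decPaths n ∧
            riseTouch p.1 p.2 = (a + 1) :: β ∧ (peakSet p.1 p.2).card = k ∧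
            (riseSet p.1 p.2).card = ℓ ∧ 0 ∈ p.2} →
          {p : List ℕ × Finset ℕ // p ∈ decPaths (n - 1) ∧
            (peakSet p.1 p.2).card = k ∧ (riseSet p.1 p.2).card = ℓ - 1 ∧
            ∃ γ : List ℕ, (∀ x ∈ γ, 0 < x) ∧ γ.sum = a + 1 ∧
              riseTouch p.1 p.2 = β ++ γ},
      Function.Bijective Φ ∧
        ∀ p, dinvC p.1.1 p.1.2 = dinvC (Φ p).1.1 (Φ p).1.2 + β.length ∧
             areaC p.1.1 p.1.2 = areaC (Φ p).1.1 (Φ p).1.2 + a := by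
  have forward : ∀ p : List ℕ × Finset ℕ, p ∈ decPaths n ∧
      riseTouch p.1 p.2 = (a + 1) :: β ∧ (peakSet p.1 p.2).card = k ∧
      (riseSet p.1 p.2).card = ℓ ∧ 0 ∈ p.2 → ∃ q T X, IsBlockRotation p q T X := by
    rintro p ⟨hp, ht, -, -, h0⟩
    obtain ⟨-, hd, hv⟩ := mem_decPaths.1 hp
    exact exists_isBlockRotation_right ha hd hv h0 ht
  have touch : ∀ {p q : List ℕ × Finset ℕ} {T X : List ℕ}, IsBlockRotation p q T X →
      riseTouch p.1 p.2 = (a + 1) :: β → T.count 0 = β.length ∧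
      (∃ γ : List ℕ, (∀ x ∈ γ, 0 < x) ∧ γ.sum = a + 1 ∧ riseTouch q.1 q.2 = β ++ γ) ∧
      a + 1 + ((riseSet q.1 q.2).filter (T.length ≤ ·)).card = X.length := by
    intro p q T X h ht
    obtain ⟨γ, h1, h2, h3, h4⟩ := h.exists_riseTouch
    rw [h1, List.cons.injEq] at ht
    obtain ⟨hγ, hβ'⟩ := ht
    rw [hβ'] at h2
    refine ⟨by rw [← length_riseTouch T q.2, hβ'], ⟨γ, h3, hγ, h2⟩, by rw [← hγ, h4]⟩
  choose! F T X hF using forward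
  refine ⟨fun p => ⟨F p.1, ?_⟩, ⟨?_, ?_⟩, ?_⟩
  · obtain ⟨p, hp⟩ := p
    have h := hF p hp
    obtain ⟨hmem, ht, hpk, hrs, -⟩ := hp
    obtain ⟨hlen, hd, hv⟩ := mem_decPaths.1 hmem
    have r := h.isRotation
    have := r.length_left
    have := r.length_right
    have := r.card_riseSet
    refine ⟨mem_decPaths.2 ⟨?_, r.isDyck_right hd, r.validDec_iff.1 hv⟩, ?_, ?_,
      (touch h ht).2.1⟩
    · simp only
      omega
    · rw [← r.card_peakSet, hpk]
    · simp only
      omega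
  · rintro ⟨p₁, hp₁⟩ ⟨p₂, hp₂⟩ e
    have e' : F p₁ = F p₂ := congrArg Subtype.val e
    have h₁ := hF p₁ hp₁
    have h₂ := hF p₂ hp₂
    rw [e'] at h₁
    refine Subtype.ext (h₁.eq_left h₂ ?_)
    rw [(touch h₁ hp₁.2.1).1, (touch h₂ hp₂.2.1).1]
  · rintro ⟨q, hmem, hpk, hrs, γ, hγ, hsum, ht⟩
    obtain ⟨hlen, hd, hv⟩ := mem_decPaths.1 hmem
    have hγ0 : 0 < γ.length := by
      refine List.length_pos_iff.2 ?_
      rintro rfl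
      simp at hsum
    have hcount : q.1.count 0 = β.length + γ.length := by
      rw [← length_riseTouch q.1 q.2, ht, List.length_append]
    obtain ⟨p, T', X', h, hT'⟩ :=
      exists_isBlockRotation_left (b := β.length) hd hv (by omega)
    have r := h.isRotation
    obtain ⟨γ', h1, h2, -, -⟩ := h.exists_riseTouch
    obtain ⟨e1, e2⟩ := List.append_inj (ht.symm.trans h2) (by rw [length_riseTouch, hT'])
    have := r.length_left
    have := r.length_right
    have hp : p ∈ decPaths n ∧ riseTouch p.1 p.2 = (a + 1) :: β ∧ (peakSet p.1 p.2).card = k ∧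
        (riseSet p.1 p.2).card = ℓ ∧ 0 ∈ p.2 := by
      refine ⟨mem_decPaths.2 ⟨by omega, r.isDyck_left hd, r.validDec_iff.2 hv⟩, ?_, ?_, ?_,
        r.zero_mem⟩
      · rw [h1, ← e1, ← e2, hsum]
      · rw [r.card_peakSet, hpk]
      · rw [r.card_riseSet, hrs]
        omega
    exact ⟨⟨p, hp⟩, Subtype.ext ((hF p hp).eq_right h)⟩
  · rintro ⟨p, hp⟩
    have h := hF p hp
    have r := h.isRotation
    have ht := hp.2.1
    have hb := bval_zero (l := p.1) (by rw [r.length_left]; omega) r.ent_zero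
    rw [← length_riseTouch p.1 p.2, ht, List.length_cons] at hb
    have hA := r.areaC_eq
    have hX := (touch h ht).2.2
    refine ⟨?_, ?_⟩
    · simp only
      rw [r.dinvC_eq]
      omega
    · simp only
      omega
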